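/- arXiv:1502.07556 — 11 statements merged into one kernel-verified Lean document; each statement's English description precedes it below -/
import Mathlib

section
/- Let g, g', η, μ, ℓ be integers with g ≥ 4, η ≥ 1, μ ≥ 1, ℓ ≥ 1, g' ≥ 0, g = g' + η + μ, and such that η = 1 implies μ = 1. If 2g' = (ℓ−1)((2−g)ℓ + 2(2g−η−3)), then ℓ ≤ 3. -/
/-- Arithmetic content of Theorem 2.1(i) (smooth surface scroll case):
with `g = g' + η + μ`, `η, μ ≥ 1`, `η = 1 → μ = 1`, the genus relation forces `ℓ ≤ 3`. -/
theorem stmt_1 (g g' η μ ℓ : ℤ) (hg : 4 ≤ g) (hη : 1 ≤ η) (hμ : 1 ≤ μ) (hℓ : 1 ≤ ℓ)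
    (hg' : 0 ≤ g') (hgsum : g = g' + η + μ) (hkunz : η = 1 → μ = 1)
    (heq : 2 * g' = (ℓ - 1) * ((2 - g) * ℓ + 2 * (2 * g - η - 3))) :
    ℓ ≤ 3 := by
  by_contra! hlt
  have hF : 0 ≤ (2 - g) * ℓ + 2 * (2 * g - η - 3) :=
    nonneg_of_mul_nonneg_right (by linarith) (by linarith : 0 < ℓ - 1)
  have hprod : 0 ≤ (g - 2) * (ℓ - 4) := mul_nonneg (by linarith) (by linarith)
  have hη1 : η = 1 := by linarith
  have hF0 : (2 - g) * ℓ + 2 * (2 * g - η - 3) = 0 := by linarith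
  rw [hF0, mul_zero] at heq
  linarith [hkunz hη1]
end

section
/- Let g, η, μ, a, b, c, d be integers with g ≥ 6, η ≥ 1, μ ≥ 1, η + μ ≤ g, a ≥ 1, c ≥ 1, and such that a = 1 implies b ≥ 0 and c = 1 implies d ≥ 0. Set u = a + c, v = b + d and ℓ = a·c, and suppose that (u−4)(2g−2−η) + η + 2μ + ℓ(v + g − 5) = 0. If v = −(g−5), then u = 3, ℓ = 2 and g = 1 + η + μ. -/
/-- Arithmetic core of the proof of Theorem 4.1(i): with `u = a + c`, `v = b + d`,
`ℓ = a·c` and the genus relation `(u−4)(2g−2−η) + η + 2μ + ℓ(v+g−5) = 0`,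
if `v = −(g−5)` then `u = 3`, `ℓ = 2` and `g = 1 + η + μ`. -/
theorem stmt_3 (g η μ a b c d : ℤ) (hg : 6 ≤ g) (hη : 1 ≤ η) (hμ : 1 ≤ μ)
    (hsum : η + μ ≤ g) (ha : 1 ≤ a) (hc : 1 ≤ c)
    (hab : a = 1 → 0 ≤ b) (hcd : c = 1 → 0 ≤ d)
    (u v ℓ : ℤ) (hu : u = a + c) (hv : v = b + d) (hℓ : ℓ = a * c)
    (heq : (u - 4) * (2 * g - 2 - η) + η + 2 * μ + ℓ * (v + g - 5) = 0)
    (hveq : v = -(g - 5)) :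
    u = 3 ∧ ℓ = 2 ∧ g = 1 + η + μ := by
  have hv0 : v + g - 5 = 0 := by lia
  rw [hv0, mul_zero, add_zero] at heq
  have hu3 : u = 3 := by
    have hlt : u < 4 := by
      by_contra! h
      nlinarith [mul_nonneg (sub_nonneg.2 h) (by lia : 0 ≤ 2 * g - 2 - η)]
    lia
  subst hu3
  refine ⟨rfl, ?_, by lia⟩
  obtain ⟨rfl, rfl⟩ | ⟨rfl, rfl⟩ : a = 1 ∧ c = 2 ∨ a = 2 ∧ c = 1 := by lia
  all_goals lia
end

section
/- Let S be a numerical semigroup with S ≠ ℕ, Frobenius number γ = max(ℕ∖S) and multiplicity α = min(S∖{0}), and set K* = {a ∈ ℕ : a ≤ γ and γ − a ∉ S}. Suppose that K* = {0, 1, …, a} ∪ {γ−α+1, …, γ−1} for some natural number a with a < γ − α. Then S ∩ [0, γ] = {0} ∪ {α, α+1, …, γ−a−1}, and the set {s + 1 : s ∈ S} ∖ S has exactly 2 elements, namely 1 and γ − a. -/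
/-- The `r = 1` case in the proof of Theorem 3.3: if
`K* = {0,…,a} ∪ {γ−α+1,…,γ−1}` with `a + α < γ`, then
`S ∩ [0,γ] = {0} ∪ {α,…,γ−a−1}`, and `{s+1 : s ∈ S} ∖ S = {1, γ−a}`
has exactly `2` elements. -/
theorem stmt_7 (S : Set ℕ) (h0 : 0 ∈ S) (hadd : ∀ a ∈ S, ∀ b ∈ S, a + b ∈ S)
    (hfin : Sᶜ.Finite) (hne : S ≠ Set.univ)
    (γ α a : ℕ) (hγ : IsGreatest Sᶜ γ) (hα : IsLeast (S \ {0}) α)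
    (ha : a + α < γ)
    (hK : {x : ℕ | x ≤ γ ∧ γ - x ∉ S} =
      Set.Icc 0 a ∪ Set.Icc (γ - α + 1) (γ - 1)) :
    S ∩ Set.Icc 0 γ = {0} ∪ Set.Icc α (γ - a - 1) ∧
    ((fun s => s + 1) '' S) \ S = {1, γ - a} ∧
    (((fun s => s + 1) '' S) \ S).ncard = 2 := by
  have hγS : γ ∉ S := hγ.1
  have large_mem : ∀ s, γ < s → s ∈ S := fun s hs => by
    by_contra h
    exact absurd (hγ.2 h) (by omega)
  have hα_ne : α ≠ 0 := hα.1.2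
  have mem_iff : ∀ s, s ≤ γ → (s ∈ S ↔ s = 0 ∨ α ≤ s ∧ s ≤ γ - a - 1) := fun s hs => by
    have h := Set.ext_iff.mp hK (γ - s)
    simp only [Set.mem_ofPred_eq, Set.mem_union, Set.mem_Icc, Nat.sub_sub_self hs] at h
    by_cases hsS : s ∈ S
    · simp only [hsS, not_true_eq_false, and_false, false_iff] at h
      simp only [hsS, true_iff]
      omega
    · simp only [hsS, not_false_eq_true, and_true] at h
      simp only [hsS, false_iff]
      rintro (rfl | h')
      · exact hsS h0
      · omega
  have hα_ne_one : α ≠ 1 := by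
    rintro rfl
    have all_mem : ∀ n : ℕ, n ∈ S := fun n => by
      induction n with
      | zero => exact h0
      | succ n ih => exact hadd n ih 1 hα.1.1
    exact hγS (all_mem γ)
  have hdiff : ((fun s => s + 1) '' S) \ S = {1, γ - a} := by
    ext x
    simp only [Set.mem_sdiff, Set.mem_image, Set.mem_insert_iff, Set.mem_singleton_iff]
    constructor
    · rintro ⟨⟨s, hs, rfl⟩, hx⟩
      have hle : s + 1 ≤ γ := by
        by_contra h
        exact hx (large_mem _ (by omega))
      rw [mem_iff _ hle] at hx
      rw [mem_iff _ (by omega)] at hs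
      omega
    · rintro (rfl | rfl)
      · refine ⟨⟨0, h0, rfl⟩, ?_⟩
        rw [mem_iff _ (by omega)]
        omega
      · refine ⟨⟨γ - a - 1, ?_, by omega⟩, ?_⟩ <;> rw [mem_iff _ (by omega)] <;> omega
  refine ⟨?_, hdiff, ?_⟩
  · ext s
    simp only [Set.mem_inter_iff, Set.mem_union, Set.mem_Icc, Set.mem_singleton_iff]
    constructor
    · rintro ⟨hs, -, hle⟩
      exact (mem_iff s hle).mp hs
    · intro h
      have hle : s ≤ γ := by omega
      exact ⟨(mem_iff s hle).mpr h, Nat.zero_le s, hle⟩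
  · rw [hdiff]
    exact Set.ncard_pair (by omega)
end

section
/- Let S be a numerical semigroup with S ≠ ℕ, Frobenius number γ = max(ℕ∖S) and multiplicity α = min(S∖{0}) ≥ 3, and set K* = {a ∈ ℕ : a ≤ γ and γ − a ∉ S}. If K* can be partitioned into two pairwise disjoint subsets, each of which is an arithmetic progression with common difference 2, then the set {s + 2 : s ∈ S} ∖ S has exactly one element (namely 2). -/
/-- A finite nonempty arithmetic progression of naturals with common difference `r`:
`{x, x+r, …, x+kr}` for some `k ≥ 0` (singletons allowed). -/
def IsAP (r : ℕ) (A : Set ℕ) : Prop :=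
  ∃ x k : ℕ, A = (fun i => x + i * r) '' Set.Iic k

theorem IsAP.modEq {r : ℕ} {A : Set ℕ} (hA : IsAP r A) {u v : ℕ} (hu : u ∈ A) (hv : v ∈ A) :
    u ≡ v [MOD r] := by
  obtain ⟨x, k, rfl⟩ := hA
  obtain ⟨i, -, rfl⟩ := hu
  obtain ⟨j, -, rfl⟩ := hv
  simp [Nat.ModEq]

theorem IsAP.add_mem {r : ℕ} {A : Set ℕ} (hA : IsAP r A) {u v : ℕ} (hu : u ∈ A) (hv : v ∈ A)
    (huv : u < v) : u + r ∈ A := by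
  obtain ⟨x, k, rfl⟩ := hA
  obtain ⟨i, -, rfl⟩ := hu
  obtain ⟨j, hj, rfl⟩ := hv
  have hij : i < j := lt_of_mul_lt_mul_right (Nat.lt_of_add_lt_add_left huv) (Nat.zero_le r)
  exact ⟨i + 1, (Nat.succ_le_of_lt hij).trans hj, by ring⟩

/-- The `r = 2` case in the proof of Theorem 3.3: if `α ≥ 3` and
`K* = {a ∈ ℕ : a ≤ γ ∧ γ − a ∉ S}` is the disjoint union of two arithmetic
progressions with common difference `2`, then `{s+2 : s ∈ S} ∖ S = {2}`. -/
theorem stmt_8 (S : Set ℕ) (h0 : 0 ∈ S) (hadd : ∀ a ∈ S, ∀ b ∈ S, a + b ∈ S)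
    (hfin : Sᶜ.Finite) (hne : S ≠ Set.univ)
    (γ α : ℕ) (hγ : IsGreatest Sᶜ γ) (hα : IsLeast (S \ {0}) α) (hα3 : 3 ≤ α)
    (hpart : ∃ A₁ A₂ : Set ℕ, {x : ℕ | x ≤ γ ∧ γ - x ∉ S} = A₁ ∪ A₂ ∧
      Disjoint A₁ A₂ ∧ IsAP 2 A₁ ∧ IsAP 2 A₂) :
    ((fun s => s + 2) '' S) \ S = {2} := by
  have hle : ∀ s ∈ S, s ≠ 0 → 3 ≤ s := fun s hs hs0 => hα3.trans (hα.2 ⟨hs, hs0⟩)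
  have h1 : 1 ∉ S := fun h => absurd (hle 1 h one_ne_zero) (by norm_num)
  have h2 : 2 ∉ S := fun h => absurd (hle 2 h two_ne_zero) (by norm_num)
  have hγ2 : 2 ≤ γ := hγ.2 h2
  refine Set.Subset.antisymm ?_ (Set.singleton_subset_iff.2 ⟨⟨0, h0, rfl⟩, h2⟩)
  rintro _ ⟨⟨s, hs, rfl⟩, hs2⟩
  by_contra hne2
  have hs3 : 3 ≤ s := hle s hs fun h => hne2 (by simp [h])
  have hsγ : s + 2 ≤ γ := hγ.2 hs2
  obtain ⟨A₁, A₂, hK, -, hA₁, hA₂⟩ := hpart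
  have hmem : ∀ g ≤ γ, g ∉ S → γ - g ∈ A₁ ∪ A₂ := fun g hg hgS => by
    rw [← hK]
    exact ⟨Nat.sub_le _ _, by rwa [Nat.sub_sub_self hg]⟩
  have hnot : γ - (s + 2) + 2 ∉ A₁ ∪ A₂ := fun h => by
    rw [← hK] at h
    exact h.2 (by rwa [show γ - (γ - (s + 2) + 2) = s by omega])
  have step : ∀ A B : Set ℕ, IsAP 2 A → IsAP 2 B → (∀ g ≤ γ, g ∉ S → γ - g ∈ A ∪ B) →
      γ - (s + 2) ∈ A → γ - (s + 2) + 2 ∈ A := fun A B hA hB hAB hu => by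
    rcases hAB 1 (by omega) h1 with hv | hv
    · exact hA.add_mem hu hv (by omega)
    rcases hAB 2 hγ2 h2 with hw | hw
    · exact hA.add_mem hu hw (by omega)
    have := hB.modEq hv hw
    unfold Nat.ModEq at this
    omega
  rcases hmem (s + 2) hsγ hs2 with hu | hu
  · exact hnot (Or.inl (step A₁ A₂ hA₁ hA₂ hmem hu))
  · exact hnot (Or.inr (step A₂ A₁ hA₂ hA₁ (by simpa only [Set.union_comm] using hmem) hu))
end

section
/- Let S be a numerical semigroup with S ≠ ℕ, Frobenius number γ = max(ℕ∖S) and multiplicity α = min(S∖{0}), and set K* = {a ∈ ℕ : a ≤ γ and γ − a ∉ S}. Suppose that K* = {0, 1, …, a} ∪ {b, b+1, …, c} ∪ {γ−α+1, …, γ−1} for natural numbers a, b, c with a + 1 < b, b ≤ c and c < γ − α. Then S ∩ [0, γ] = {0} ∪ {α, α+1, …, γ−c−1} ∪ {γ−b+1, …, γ−a−1}, and the set {s + 1 : s ∈ S} ∖ S has exactly 3 elements, namely 1, γ − c and γ − a. -/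
/-- A set of naturals containing `0` and `1` and closed under addition contains everything. -/
theorem mem_of_one_mem_of_add_mem {S : Set ℕ} (h0 : 0 ∈ S)
    (hadd : ∀ a ∈ S, ∀ b ∈ S, a + b ∈ S) (h1 : 1 ∈ S) (n : ℕ) : n ∈ S := by
  induction n with
  | zero => exact h0
  | succ n ih => exact hadd n ih 1 h1

/-- The `r = 1` case in the proof of Theorem 5.1 (necessity): if
`K* = {0,…,a} ∪ {b,…,c} ∪ {γ−α+1,…,γ−1}` with `a+1 < b ≤ c` and `c + α < γ`,
then `S ∩ [0,γ] = {0} ∪ {α,…,γ−c−1} ∪ {γ−b+1,…,γ−a−1}`, and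
`{s+1 : s ∈ S} ∖ S = {1, γ−c, γ−a}` has exactly `3` elements. -/
theorem stmt_10 (S : Set ℕ) (h0 : 0 ∈ S) (hadd : ∀ a ∈ S, ∀ b ∈ S, a + b ∈ S)
    (hfin : Sᶜ.Finite) (hne : S ≠ Set.univ)
    (γ α a b c : ℕ) (hγ : IsGreatest Sᶜ γ) (hα : IsLeast (S \ {0}) α)
    (hab : a + 1 < b) (hbc : b ≤ c) (hc : c + α < γ)
    (hK : {x : ℕ | x ≤ γ ∧ γ - x ∉ S} =
      Set.Icc 0 a ∪ Set.Icc b c ∪ Set.Icc (γ - α + 1) (γ - 1)) :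
    S ∩ Set.Icc 0 γ =
      {0} ∪ Set.Icc α (γ - c - 1) ∪ Set.Icc (γ - b + 1) (γ - a - 1) ∧
    ((fun s => s + 1) '' S) \ S = {1, γ - c, γ - a} ∧
    (((fun s => s + 1) '' S) \ S).ncard = 3 := by
  obtain ⟨hγS, hγ_max⟩ := hγ
  obtain ⟨⟨hαS, hα0⟩, -⟩ := hα
  have hα_pos : 0 < α := Nat.pos_of_ne_zero hα0
  have h1 : 1 ∉ S := fun h => hγS (mem_of_one_mem_of_add_mem h0 hadd h γ)
  have hα1 : α ≠ 1 := fun h => h1 (h ▸ hαS)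
  have mem_iff : ∀ y, y ≤ γ → (y ∈ S ↔
      y = 0 ∨ (α ≤ y ∧ y ≤ γ - c - 1) ∨ (γ - b + 1 ≤ y ∧ y ≤ γ - a - 1)) := by
    intro y hy
    have h := Set.ext_iff.mp hK (γ - y)
    simp only [Set.mem_ofPred_eq, Set.mem_union, Set.mem_Icc, Nat.sub_sub_self hy] at h
    by_cases hyS : y ∈ S
    · simp only [hyS, true_iff, not_true_eq_false, and_false, false_iff] at h ⊢
      omega
    · simp only [hyS, false_iff, not_false_eq_true, and_true] at h ⊢
      have := h.mp (Nat.sub_le γ y)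
      omega
  have succ_diff : ((fun s => s + 1) '' S) \ S = {1, γ - c, γ - a} := by
    ext y
    simp only [Set.mem_sdiff, Set.mem_image, Set.mem_insert_iff, Set.mem_singleton_iff]
    constructor
    · rintro ⟨⟨s, hs, rfl⟩, hsS⟩
      have hle : s + 1 ≤ γ := hγ_max hsS
      rw [mem_iff _ hle] at hsS
      rw [mem_iff s (by omega)] at hs
      omega
    · intro hy
      have hle : y ≤ γ := by omega
      refine ⟨⟨y - 1, ?_, by omega⟩, ?_⟩
      · rw [mem_iff _ (by omega)]
        omega
      · rw [mem_iff _ hle]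
        omega
  refine ⟨?_, succ_diff, ?_⟩
  · ext y
    simp only [Set.mem_inter_iff, Set.mem_union, Set.mem_Icc, Set.mem_singleton_iff]
    constructor
    · rintro ⟨hyS, -, hy⟩
      rw [mem_iff y hy] at hyS
      omega
    · intro h
      have hy : y ≤ γ := by omega
      refine ⟨?_, Nat.zero_le y, hy⟩
      rw [mem_iff y hy]
      omega
  · rw [succ_diff, Set.ncard_eq_three]
    exact ⟨1, γ - c, γ - a, by omega, by omega, by omega, rfl⟩
end

section
/- Let S be a numerical semigroup with S ≠ ℕ, Frobenius number γ = max(ℕ∖S) and multiplicity α = min(S∖{0}) ≥ 3, and set K* = {a ∈ ℕ : a ≤ γ and γ − a ∉ S}. If K* can be partitioned into at most three pairwise disjoint subsets, each of which is an arithmetic progression with common difference 2, then the set {s + 2 : s ∈ S} ∖ S has at most 2 elements. -/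
/-- An element of an arithmetic progression of difference `r` whose successor is missing
is determined by the progression. -/
theorem IsAP.eq_of_add_notMem {r : ℕ} {A : Set ℕ} (hA : IsAP r A) {u v : ℕ}
    (hu : u ∈ A) (hv : v ∈ A) (hu' : u + r ∉ A) (hv' : v + r ∉ A) : u = v := by
  obtain ⟨x, k, rfl⟩ := hA
  have last : ∀ w ∈ (fun i => x + i * r) '' Set.Iic k,
      w + r ∉ (fun i => x + i * r) '' Set.Iic k → w = x + k * r := by
    rintro _ ⟨i, hi, rfl⟩ hw
    have hik : i = k := by
      by_contra hne
      exact hw ⟨i + 1, Nat.lt_of_le_of_ne hi hne, by ring⟩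
    simp only [hik]
  rw [last u hu hu', last v hv hv']

/-- The `r = 2` case in the proof of Theorem 5.1 (necessity): if `α ≥ 3` and
`K*` can be partitioned into at most three pairwise disjoint arithmetic
progressions with common difference `2`, then `{s+2 : s ∈ S} ∖ S` has at most
`2` elements. -/
theorem stmt_11 (S : Set ℕ) (h0 : 0 ∈ S) (hadd : ∀ a ∈ S, ∀ b ∈ S, a + b ∈ S)
    (hfin : Sᶜ.Finite) (hne : S ≠ Set.univ)
    (γ α : ℕ) (hγ : IsGreatest Sᶜ γ) (hα : IsLeast (S \ {0}) α) (hα3 : 3 ≤ α)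
    (hpart : ∃ A : Fin 3 → Set ℕ, {x : ℕ | x ≤ γ ∧ γ - x ∉ S} = ⋃ i, A i ∧
      (Pairwise fun i j => Disjoint (A i) (A j)) ∧
      (∀ i, A i = ∅ ∨ IsAP 2 (A i))) :
    (((fun s => s + 2) '' S) \ S).ncard ≤ 2 := by
  obtain ⟨A, hA, -, hAP⟩ := hpart
  have h1 : (1 : ℕ) ∉ S := fun h => by
    have := hα.2 ⟨h, one_ne_zero⟩
    omega
  set T : Set ℕ := ((fun s => s + 2) '' S) \ S
  have hTfin : T.Finite := hfin.subset fun x hx => hx.2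
  have hgap : ∀ x ∈ insert 1 T, x ∉ S := by
    rintro x (rfl | hx)
    exacts [h1, hx.2]
  have hpred : ∀ x ∈ insert 1 T, ∀ y, y + 2 = x → y ∈ S := by
    rintro x (rfl | ⟨⟨s, hs, rfl⟩, -⟩) y hy
    · omega
    · rwa [Nat.add_right_cancel hy]
  have hle : ∀ x ∈ insert 1 T, x ≤ γ := fun x hx => hγ.2 (hgap x hx)
  have hmem : ∀ x ∈ insert 1 T, ∃ i, γ - x ∈ A i := fun x hx => by
    rw [← Set.mem_iUnion, ← hA]
    exact ⟨Nat.sub_le _ _, by rw [Nat.sub_sub_self (hle x hx)]; exact hgap x hx⟩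
  have hnext : ∀ x ∈ insert 1 T, ∀ i, γ - x + 2 ∉ A i := fun x hx i hi => by
    have hK : γ - x + 2 ∈ {x : ℕ | x ≤ γ ∧ γ - x ∉ S} := hA ▸ Set.mem_iUnion_of_mem i hi
    have hxγ := hle x hx
    have hbound := hK.1
    exact hK.2 (hpred x hx _ (by omega))
  choose! f hf using hmem
  have hcard : (insert 1 T).ncard ≤ (Set.univ : Set (Fin 3)).ncard := by
    refine Set.ncard_le_ncard_of_injOn f (fun _ _ => Set.mem_univ _) fun x hx y hy hxy => ?_
    have hy' := hf y hy
    rw [← hxy] at hy'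
    have hap := (hAP (f x)).resolve_left (Set.Nonempty.ne_empty ⟨_, hf x hx⟩)
    have := hap.eq_of_add_notMem (hf x hx) hy' (hnext x hx _) (hnext y hy _)
    have hxγ := hle x hx
    have hyγ := hle y hy
    omega
  have h1T : 1 ∉ T := by
    rintro ⟨⟨s, -, hs⟩, -⟩
    simp at hs
  rw [Set.ncard_insert_of_notMem h1T hTfin, Set.ncard_univ, Nat.card_fin] at hcard
  omega
end

section
/- Let S be a numerical semigroup with S ≠ ℕ, Frobenius number γ = max(ℕ∖S) and multiplicity α = min(S∖{0}) ≥ 4, and set K* = {a ∈ ℕ : a ≤ γ and γ − a ∉ S}. If K* can be partitioned into three pairwise disjoint subsets, each of which is an arithmetic progression with common difference 3, then the set {s + 3 : s ∈ S} ∖ S has exactly one element (namely 3). -/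
/-- The `r = 3` case in the proof of Theorem 5.1 (necessity): if `α ≥ 4` and
`K*` can be partitioned into three pairwise disjoint arithmetic progressions
with common difference `3`, then `{s+3 : s ∈ S} ∖ S = {3}`. -/
theorem stmt_12 (S : Set ℕ) (h0 : 0 ∈ S) (hadd : ∀ a ∈ S, ∀ b ∈ S, a + b ∈ S)
    (hfin : Sᶜ.Finite) (hne : S ≠ Set.univ)
    (γ α : ℕ) (hγ : IsGreatest Sᶜ γ) (hα : IsLeast (S \ {0}) α) (hα4 : 4 ≤ α)
    (hpart : ∃ A : Fin 3 → Set ℕ, {x : ℕ | x ≤ γ ∧ γ - x ∉ S} = ⋃ i, A i ∧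
      (Pairwise fun i j => Disjoint (A i) (A j)) ∧
      (∀ i, IsAP 3 (A i))) :
    ((fun s => s + 3) '' S) \ S = {3} := by
  obtain ⟨A, hA, -, hAP⟩ := hpart
  have hle : ∀ n, n ∉ S → n ≤ γ := fun n hn => hγ.2 hn
  have hsmall : ∀ n, 0 < n → n < 4 → n ∉ S := fun n hn hn4 hnS =>
    absurd (hα.2 ⟨hnS, by simpa using hn.ne'⟩) (by omega)
  have hcover : ∀ n, n ∉ S → ∃ i, γ - n ∈ A i := fun n hn => by
    have hmem : γ - n ∈ {x : ℕ | x ≤ γ ∧ γ - x ∉ S} :=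
      ⟨Nat.sub_le _ _, by rwa [Nat.sub_sub_self (hle n hn)]⟩
    rw [hA] at hmem
    exact Set.mem_iUnion.mp hmem
  have h3 : 3 ≤ γ := hle 3 (hsmall 3 (by omega) (by omega))
  have hf : ∀ e : Fin 3, ∃ i, γ - (e.val + 1) ∈ A i := fun e =>
    hcover _ (hsmall _ (by omega) (by omega))
  choose f hf using hf
  have hinj : Function.Injective f := fun a b hab => by
    have ha := hf a
    have hb := hf b
    obtain ⟨x, k, hxk⟩ := hAP (f a)
    rw [← hab, hxk] at hb
    rw [hxk] at ha
    obtain ⟨t, -, ht⟩ := ha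
    obtain ⟨u, -, hu⟩ := hb
    dsimp only at ht hu
    ext
    omega
  have hsurj : Function.Surjective f := Finite.surjective_of_injective hinj
  ext g
  simp only [Set.mem_sdiff, Set.mem_image, Set.mem_singleton_iff]
  constructor
  · rintro ⟨⟨s, hs, rfl⟩, hg⟩
    by_contra hs0
    obtain ⟨m, hm⟩ := hcover _ hg
    obtain ⟨e, rfl⟩ := hsurj m
    have he := hf e
    have hgγ := hle _ hg
    obtain ⟨x, k, hxk⟩ := hAP (f e)
    rw [hxk] at hm he
    obtain ⟨t, -, ht⟩ := hm
    obtain ⟨u, hu, hu'⟩ := he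
    dsimp only at ht hu'
    rw [Set.mem_Iic] at hu
    have hmem : γ - s ∈ A (f e) := by
      rw [hxk]
      exact ⟨t + 1, Set.mem_Iic.mpr (by omega), by dsimp only; omega⟩
    have hK : γ - s ∈ {x : ℕ | x ≤ γ ∧ γ - x ∉ S} := hA ▸ Set.mem_iUnion.mpr ⟨_, hmem⟩
    exact hK.2 (by rwa [Nat.sub_sub_self (by omega)])
  · rintro rfl
    exact ⟨⟨0, h0, rfl⟩, hsmall 3 (by omega) (by omega)⟩
end

section
/- Let S be a numerical semigroup with S ≠ ℕ, Frobenius number γ = max(ℕ∖S), and set K* = {a ∈ ℕ : a ≤ γ and γ − a ∉ S}. If the set {s ∈ S : s + 1 ∉ S} has exactly 3 elements, then K* can be partitioned into at most three pairwise disjoint nonempty subsets, each of which is a set of consecutive integers. -/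
/-- The reflection `y ↦ γ - y` of the run of gaps of `S` that starts right after `s`. -/
def reflectedGapRun (S : Set ℕ) (γ s : ℕ) : Set ℕ :=
  {x | s < γ - x ∧ ∀ y, s < y → y ≤ γ - x → y ∉ S}

theorem reflectedGapRun_eq_Icc {S : Set ℕ} {γ s : ℕ} (hs : s + 1 ∉ S) (hsγ : s + 1 ≤ γ) :
    ∃ x y : ℕ, x ≤ y ∧ reflectedGapRun S γ s = Set.Icc x y := by
  classical
  have hmem : γ - (s + 1) ∈ reflectedGapRun S γ s := by
    refine ⟨by omega, fun y hy hy' => ?_⟩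
    obtain rfl : y = s + 1 := by omega
    exact hs
  have hex : ∃ x, x ∈ reflectedGapRun S γ s := ⟨_, hmem⟩
  refine ⟨Nat.find hex, γ - (s + 1), Nat.find_min' hex hmem, Set.ext fun x => ⟨fun hx => ?_, ?_⟩⟩
  · have hsx := hx.1
    exact ⟨Nat.find_min' hex hx, by omega⟩
  · rintro ⟨hlo, hhi⟩
    exact ⟨by omega, fun y hy hy' => (Nat.find_spec hex).2 y hy (by omega)⟩

theorem disjoint_reflectedGapRun {S : Set ℕ} {γ s t : ℕ} (hs : s ∈ S) (ht : t ∈ S)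
    (hst : s ≠ t) : Disjoint (reflectedGapRun S γ s) (reflectedGapRun S γ t) := by
  refine Set.disjoint_left.2 fun x hxs hxt => ?_
  rcases hst.lt_or_gt with h | h
  · exact hxs.2 t h hxt.1.le ht
  · exact hxt.2 s h hxs.1.le hs

/-- Every gap lies in the run of gaps after some `s ∈ S` with `s + 1 ∉ S`. -/
theorem exists_gap_run {S : Set ℕ} (h0 : 0 ∈ S) {g : ℕ} (hg : g ∉ S) :
    ∃ s ∈ S, s + 1 ∉ S ∧ s < g ∧ ∀ y, s < y → y ≤ g → y ∉ S := by
  induction g with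
  | zero => exact absurd h0 hg
  | succ n ih =>
    by_cases hn : n ∈ S
    · refine ⟨n, hn, hg, n.lt_succ_self, fun y hy hy' => ?_⟩
      obtain rfl : y = n + 1 := by omega
      exact hg
    · obtain ⟨s, hs, hs', hsn, hrun⟩ := ih hn
      refine ⟨s, hs, hs', by omega, fun y hy hy' => ?_⟩
      rcases hy'.eq_or_lt with rfl | h
      · exact hg
      · exact hrun y hy (by omega)


/-- The case `n = 1` in the sufficiency part of Theorem 5.1: if
`{s ∈ S : s+1 ∉ S}` has exactly `3` elements, then
`K* = {a ∈ ℕ : a ≤ γ ∧ γ − a ∉ S}` is a union of at most three pairwise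
disjoint nonempty sets of consecutive integers. -/
theorem stmt_14 (S : Set ℕ) (h0 : 0 ∈ S) (hadd : ∀ a ∈ S, ∀ b ∈ S, a + b ∈ S)
    (hfin : Sᶜ.Finite) (hne : S ≠ Set.univ)
    (γ : ℕ) (hγ : IsGreatest Sᶜ γ)
    (hcard : {s ∈ S | s + 1 ∉ S}.ncard = 3) :
    ∃ A : Fin 3 → Set ℕ, {x : ℕ | x ≤ γ ∧ γ - x ∉ S} = ⋃ i, A i ∧
      (Pairwise fun i j => Disjoint (A i) (A j)) ∧
      (∀ i, A i = ∅ ∨ ∃ x y : ℕ, x ≤ y ∧ A i = Set.Icc x y) := by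
  have : Finite {s ∈ S | s + 1 ∉ S} := Set.finite_of_ncard_ne_zero (by omega)
  let e := Finite.equivFinOfCardEq ((Nat.card_coe_set_eq _).trans hcard)
  refine ⟨fun i => reflectedGapRun S γ (e.symm i), ?_, fun i j hij => ?_, fun i => Or.inr ?_⟩
  · ext x
    simp only [Set.mem_iUnion, Set.mem_ofPred_eq]
    constructor
    · rintro ⟨-, hxS⟩
      obtain ⟨s, hs, hs', hrun⟩ := exists_gap_run h0 hxS
      exact ⟨e ⟨s, hs, hs'⟩, by simpa [reflectedGapRun] using hrun⟩
    · rintro ⟨i, hlt, hrun⟩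
      exact ⟨by omega, hrun _ hlt le_rfl⟩
  · exact disjoint_reflectedGapRun (e.symm i).2.1 (e.symm j).2.1
      fun h => hij (e.symm.injective (Subtype.ext h))
  · exact reflectedGapRun_eq_Icc (e.symm i).2.2 (hγ.2 (e.symm i).2.2)
end

section
/- Let S be a numerical semigroup with S ≠ ℕ, Frobenius number γ = max(ℕ∖S), and set K* = {a ∈ ℕ : a ≤ γ and γ − a ∉ S}. If the set {s ∈ S : s + 2 ∉ S} has exactly 2 elements, then K* can be partitioned into at most three pairwise disjoint subsets, each of which is an arithmetic progression with common difference 2. -/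
/-- The maximal progression `x, x + 2, x + 4, …` of elements outside `S` starting at `x`;
it is empty when `x ∈ S`. -/
def gapRun (S : Set ℕ) (x : ℕ) : Set ℕ :=
  {y | ∃ i, y = x + i * 2 ∧ ∀ j ≤ i, x + j * 2 ∉ S}

theorem notMem_of_mem_gapRun {S : Set ℕ} {x y : ℕ} (h : y ∈ gapRun S x) : y ∉ S := by
  obtain ⟨i, rfl, hi⟩ := h
  exact hi i le_rfl

theorem self_mem_gapRun {S : Set ℕ} {x : ℕ} (h : x ∉ S) : x ∈ gapRun S x := by
  refine ⟨0, by simp, fun j hj => ?_⟩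
  obtain rfl : j = 0 := by omega
  simpa using h

theorem add_two_mem_gapRun {S : Set ℕ} {x y : ℕ} (hy : y ∈ gapRun S x) (h : y + 2 ∉ S) :
    y + 2 ∈ gapRun S x := by
  obtain ⟨i, rfl, hi⟩ := hy
  refine ⟨i + 1, by ring, fun j hj => ?_⟩
  rcases Nat.lt_or_ge i j with hij | hij
  · obtain rfl : j = i + 1 := by omega
    rwa [Nat.add_one_mul, ← Nat.add_assoc]
  · exact hi j hij

theorem gapRun_eq_empty_or_isAP {S : Set ℕ} {γ : ℕ} (hγ : γ ∈ upperBounds Sᶜ) (x : ℕ) :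
    gapRun S x = ∅ ∨ IsAP 2 (gapRun S x) := by
  classical
  have hex : ∃ m, x + m * 2 ∈ S := by
    refine ⟨γ + 1, by_contra fun h => ?_⟩
    have := hγ h
    omega
  rcases h : Nat.find hex with _ | k
  · left
    have hx : x + 0 * 2 ∈ S := h ▸ Nat.find_spec hex
    ext y
    simp only [Set.mem_empty_iff_false, iff_false]
    rintro ⟨i, -, hi⟩
    exact hi 0 (Nat.zero_le i) hx
  · right
    have hk : x + (k + 1) * 2 ∈ S := h ▸ Nat.find_spec hex
    refine ⟨x, k, ?_⟩
    ext y
    constructor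
    · rintro ⟨i, rfl, hi⟩
      refine ⟨i, ?_, rfl⟩
      by_contra hik
      exact hi (k + 1) (by simpa using hik) hk
    · rintro ⟨i, hi, rfl⟩
      refine ⟨i, rfl, fun j hj => Nat.find_min hex ?_⟩
      have : i ≤ k := hi
      omega

/-- Distinct runs are disjoint as soon as neither starting point can be extended downwards. -/
theorem disjoint_gapRun {S : Set ℕ} {x y : ℕ} (hxy : x ≠ y)
    (hx : ∀ z, x = z + 2 → z ∈ S) (hy : ∀ z, y = z + 2 → z ∈ S) :
    Disjoint (gapRun S x) (gapRun S y) := by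
  wlog hlt : x < y generalizing x y
  · exact (this hxy.symm hy hx (by omega)).symm
  rw [Set.disjoint_left]
  rintro _ ⟨i, rfl, hi⟩ ⟨j, hij, -⟩
  exact hi (i - j - 1) (by omega) (hy _ (by omega))

theorem IsAP.reflect {A : Set ℕ} {r γ : ℕ} (hA : IsAP r A) (hγ : γ ∈ upperBounds A) :
    IsAP r {x | x ≤ γ ∧ γ - x ∈ A} := by
  obtain ⟨x, k, rfl⟩ := hA
  have hk : x + k * r ≤ γ := hγ ⟨k, Set.self_mem_Iic, rfl⟩
  refine ⟨γ - (x + k * r), k, ?_⟩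
  ext y
  constructor
  · rintro ⟨hy, i, hi, h⟩
    have hi' : i ≤ k := hi
    obtain ⟨j, rfl⟩ := Nat.exists_eq_add_of_le hi'
    refine ⟨j, by simp, ?_⟩
    simp only [Nat.add_mul] at h hk ⊢
    omega
  · rintro ⟨i, hi, rfl⟩
    have hi' : i ≤ k := hi
    obtain ⟨j, rfl⟩ := Nat.exists_eq_add_of_le hi'
    simp only [Nat.add_mul] at hk ⊢
    exact ⟨by omega, j, by simp, by simp only; omega⟩

/-- The case `n = 2` in the sufficiency part of Theorem 5.1: if
`{s ∈ S : s+2 ∉ S}` has exactly `2` elements, then `K*` is a union of at most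
three pairwise disjoint arithmetic progressions with common difference `2`. -/
theorem stmt_15 (S : Set ℕ) (h0 : 0 ∈ S) (hadd : ∀ a ∈ S, ∀ b ∈ S, a + b ∈ S)
    (hfin : Sᶜ.Finite) (hne : S ≠ Set.univ)
    (γ : ℕ) (hγ : IsGreatest Sᶜ γ)
    (hcard : {s ∈ S | s + 2 ∉ S}.ncard = 2) :
    ∃ A : Fin 3 → Set ℕ, {x : ℕ | x ≤ γ ∧ γ - x ∉ S} = ⋃ i, A i ∧
      (Pairwise fun i j => Disjoint (A i) (A j)) ∧
      (∀ i, A i = ∅ ∨ IsAP 2 (A i)) := by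
  obtain ⟨a, b, hab, hT⟩ := Set.ncard_eq_two.mp hcard
  have ha : a ∈ S := (hT.ge (Set.mem_insert a {b})).1
  have hb : b ∈ S := (hT.ge (Set.mem_insert_of_mem a rfl)).1
  let start : Fin 3 → ℕ := ![1, a + 2, b + 2]
  have hstart : ∀ i z, start i = z + 2 → z ∈ S := by
    intro i z h
    fin_cases i <;> simp [start] at h <;> subst h <;> assumption
  have hinj : ∀ i j, i ≠ j → start i ≠ start j := by
    intro i j hij
    fin_cases i <;> fin_cases j <;> simp [start] at hij ⊢ <;> omega
  have hcover : ∀ g, g ∉ S → ∃ i, g ∈ gapRun S (start i) := by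
    intro g
    induction g using Nat.strong_induction_on with
    | _ g ih =>
      intro hg
      match g with
      | 0 => exact absurd h0 hg
      | 1 => exact ⟨0, self_mem_gapRun hg⟩
      | g + 2 =>
        by_cases hgS : g ∈ S
        · rcases hT.le ⟨hgS, hg⟩ with rfl | rfl
          · exact ⟨1, self_mem_gapRun hg⟩
          · exact ⟨2, self_mem_gapRun hg⟩
        · obtain ⟨i, hi⟩ := ih g (by omega) hgS
          exact ⟨i, add_two_mem_gapRun hi hg⟩
  refine ⟨fun i => {x | x ≤ γ ∧ γ - x ∈ gapRun S (start i)}, ?_, fun i j hij => ?_, fun i => ?_⟩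
  · ext x
    simp only [Set.mem_ofPred_eq, Set.mem_iUnion, exists_and_left]
    exact and_congr_right fun _ =>
      ⟨hcover _, fun ⟨_, hi⟩ => notMem_of_mem_gapRun hi⟩
  · exact Set.disjoint_left.mpr fun x hx hx' =>
      Set.disjoint_left.mp (disjoint_gapRun (hinj i j hij) (hstart i) (hstart j)) hx.2 hx'.2
  · rcases gapRun_eq_empty_or_isAP hγ.2 (start i) with h | h
    · left
      simp [h]
    · exact .inr (h.reflect fun y hy => hγ.2 (notMem_of_mem_gapRun hy))
end

section
/- Let S be a numerical semigroup with S ≠ ℕ, Frobenius number γ = max(ℕ∖S) and multiplicity α = min(S∖{0}) ≥ 4, and set K* = {a ∈ ℕ : a ≤ γ and γ − a ∉ S}. If the set {s ∈ S : s + 3 ∉ S} has exactly 1 element, then K* can be partitioned into at most three pairwise disjoint subsets, each of which is an arithmetic progression with common difference 3. -/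
/-- A bounded set of naturals lying in one residue class mod `r` and convex within that class
is empty or an arithmetic progression with common difference `r`. -/
theorem eq_empty_or_isAP_of_bddAbove {r : ℕ} (hr : 0 < r) {B : Set ℕ} (hB : BddAbove B)
    (hmod : ∀ x ∈ B, ∀ y ∈ B, x ≡ y [MOD r])
    (hconv : ∀ x ∈ B, ∀ y ∈ B, ∀ i, x + i * r ≤ y → x + i * r ∈ B) :
    B = ∅ ∨ IsAP r B := by
  rcases B.eq_empty_or_nonempty with h | hne
  · exact .inl h
  refine .inr ⟨sInf B, (sSup B - sInf B) / r, ?_⟩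
  have hm := Nat.sInf_mem hne
  have hM := Nat.sSup_mem hne hB
  ext y
  simp only [Set.mem_image, Set.mem_Iic]
  constructor
  · intro hy
    have hle := Nat.sInf_le hy
    refine ⟨(y - sInf B) / r, Nat.div_le_div_right (Nat.sub_le_sub_right (le_csSup hB hy) _), ?_⟩
    rw [Nat.div_mul_cancel ((Nat.modEq_iff_dvd' hle).mp (hmod _ hm _ hy))]
    omega
  · rintro ⟨i, hi, rfl⟩
    refine hconv _ hm _ hM i ?_
    have h1 := (Nat.le_div_iff_mul_le hr).mp hi
    have h2 := Nat.sInf_le hM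
    omega

/-- If every nonzero element of `S` stays in `S` after adding `r`, so does it after adding a
multiple of `r`. -/
theorem add_mul_mem_of_add_mem {S : Set ℕ} {r : ℕ} (h : ∀ s ∈ S, s ≠ 0 → s + r ∈ S)
    {s : ℕ} (hs : s ∈ S) (hs0 : s ≠ 0) (i : ℕ) : s + i * r ∈ S := by
  induction i with
  | zero => simpa using hs
  | succ i ih =>
    rw [Nat.succ_mul, ← add_assoc]
    exact h _ ih (by omega)

/-- The case `n = 3` in the sufficiency part of Theorem 5.1: if `α ≥ 4` and
`{s ∈ S : s+3 ∉ S}` has exactly `1` element, then `K*` is a union of at most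
three pairwise disjoint arithmetic progressions with common difference `3`. -/
theorem stmt_16 (S : Set ℕ) (h0 : 0 ∈ S) (hadd : ∀ a ∈ S, ∀ b ∈ S, a + b ∈ S)
    (hfin : Sᶜ.Finite) (hne : S ≠ Set.univ)
    (γ α : ℕ) (hγ : IsGreatest Sᶜ γ) (hα : IsLeast (S \ {0}) α) (hα4 : 4 ≤ α)
    (hcard : {s ∈ S | s + 3 ∉ S}.ncard = 1) :
    ∃ A : Fin 3 → Set ℕ, {x : ℕ | x ≤ γ ∧ γ - x ∉ S} = ⋃ i, A i ∧
      (Pairwise fun i j => Disjoint (A i) (A j)) ∧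
      (∀ i, A i = ∅ ∨ IsAP 3 (A i)) := by
  have h3 : 3 ∉ S := fun h => absurd (hα.2 ⟨h, by simp⟩) (by omega)
  have hstep : ∀ s ∈ S, s ≠ 0 → s + 3 ∈ S := by
    intro s hs hs0
    by_contra hs3
    obtain ⟨a, ha⟩ := Set.ncard_eq_one.mp hcard
    have hsa : s ∈ ({a} : Set ℕ) := ha ▸ ⟨hs, hs3⟩
    have h0a : 0 ∈ ({a} : Set ℕ) := ha ▸ ⟨h0, by simpa using h3⟩
    exact hs0 (hsa.trans h0a.symm)
  refine ⟨fun i => {x | (x ≤ γ ∧ γ - x ∉ S) ∧ x % 3 = i}, ?_, ?_, ?_⟩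
  · ext x
    simp only [Set.mem_ofPred_eq, Set.mem_iUnion]
    exact ⟨fun h => ⟨⟨x % 3, Nat.mod_lt _ (by norm_num)⟩, h, rfl⟩, fun ⟨_, h, _⟩ => h⟩
  · intro i j hij
    rw [Set.disjoint_left]
    exact fun x hx hy => hij (Fin.ext (hx.2.symm.trans hy.2))
  · intro i
    refine eq_empty_or_isAP_of_bddAbove (by norm_num) ⟨γ, fun x hx => hx.1.1⟩
      (fun x hx y hy => hx.2.trans hy.2.symm) ?_
    rintro x ⟨⟨hx, hxS⟩, hxi⟩ y ⟨⟨hy, hyS⟩, -⟩ k hk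
    refine ⟨⟨hk.trans hy, fun hz => ?_⟩, by omega⟩
    by_cases hz0 : γ - (x + k * 3) = 0
    · rw [show γ - y = γ - (x + k * 3) by omega] at hyS
      exact hyS hz
    · apply hxS
      rw [show γ - x = γ - (x + k * 3) + k * 3 by omega]
      exact add_mul_mem_of_add_mem hstep hz hz0 k
end

section
/- Let S be a numerical semigroup with 4 ∈ S and 1, 2, 3 ∉ S, let γ = max(ℕ∖S) be its Frobenius number, and set K* = {a ∈ ℕ : a ≤ γ and γ − a ∉ S}. Then K* can be partitioned into at most three pairwise disjoint subsets, each of which is an arithmetic progression with common difference 4. -/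
/-- In a residue class modulo `4` whose least element `r` is a gap, the gaps of a set that is
stable under `+ 4` and contains everything above `γ` form an initial segment. -/
theorem exists_forall_add_mul_four_notMem_iff (S : Set ℕ) (hstep : ∀ a ∈ S, a + 4 ∈ S) (γ : ℕ)
    (hγ : ∀ a ∉ S, a ≤ γ) (r : ℕ) (hr : r ∉ S) :
    ∃ m, ∀ j, r + j * 4 ∉ S ↔ j ≤ m := by
  classical
  have hex : ∃ j, r + j * 4 ∈ S := by
    refine ⟨γ + 1, ?_⟩
    by_contra h
    have := hγ _ h
    omega
  have hpos : Nat.find hex ≠ 0 := by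
    intro h
    have := Nat.find_spec hex
    rw [h] at this
    exact hr (by simpa using this)
  have hup : ∀ d, r + (Nat.find hex + d) * 4 ∈ S := by
    intro d
    induction d with
    | zero => exact Nat.find_spec hex
    | succ d ih =>
      have := hstep _ ih
      rwa [show r + (Nat.find hex + (d + 1)) * 4 = r + (Nat.find hex + d) * 4 + 4 by ring]
  refine ⟨Nat.find hex - 1, fun j => ⟨fun h => ?_, fun h => Nat.find_min hex (by omega)⟩⟩
  by_contra hj
  apply h
  have := hup (j - Nat.find hex)
  rwa [show Nat.find hex + (j - Nat.find hex) = j by omega] at this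

/-- The elements `x ≤ γ` whose reflection `γ - x` is a gap congruent to `r` modulo `4`
form an arithmetic progression with common difference `4`. -/
theorem isAP_four_setOf_sub_notMem (S : Set ℕ) (hstep : ∀ a ∈ S, a + 4 ∈ S) (γ : ℕ)
    (hγ : ∀ a ∉ S, a ≤ γ) (r : ℕ) (hr4 : r < 4) (hr : r ∉ S) :
    IsAP 4 {x : ℕ | x ≤ γ ∧ γ - x ∉ S ∧ (γ - x) % 4 = r} := by
  obtain ⟨m, hm⟩ := exists_forall_add_mul_four_notMem_iff S hstep γ hγ r hr
  have hmγ : r + m * 4 ≤ γ := hγ _ ((hm m).2 le_rfl)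
  refine ⟨γ - (r + m * 4), m, ?_⟩
  ext x
  simp only [Set.mem_ofPred_eq, Set.mem_image, Set.mem_Iic]
  constructor
  · rintro ⟨hx, hxS, hmod⟩
    have hle : (γ - x) / 4 ≤ m := by
      rw [← hm]
      rwa [show r + (γ - x) / 4 * 4 = γ - x by omega]
    exact ⟨m - (γ - x) / 4, by omega, by omega⟩
  · rintro ⟨i, hi, rfl⟩
    have heq : γ - (γ - (r + m * 4) + i * 4) = r + (m - i) * 4 := by omega
    rw [heq]
    exact ⟨by omega, (hm _).2 (by omega), by omega⟩

/-- The case `n = 4` in the sufficiency part of Theorem 5.1: if `4 ∈ S` and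
`1, 2, 3 ∉ S`, then `K*` is a union of at most three pairwise disjoint
arithmetic progressions with common difference `4`. -/
theorem stmt_17 (S : Set ℕ) (h0 : 0 ∈ S) (hadd : ∀ a ∈ S, ∀ b ∈ S, a + b ∈ S)
    (hfin : Sᶜ.Finite) (hne : S ≠ Set.univ)
    (h4 : 4 ∈ S) (h1 : 1 ∉ S) (h2 : 2 ∉ S) (h3 : 3 ∉ S)
    (γ : ℕ) (hγ : IsGreatest Sᶜ γ) :
    ∃ A : Fin 3 → Set ℕ, {x : ℕ | x ≤ γ ∧ γ - x ∉ S} = ⋃ i, A i ∧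
      (Pairwise fun i j => Disjoint (A i) (A j)) ∧
      (∀ i, A i = ∅ ∨ IsAP 4 (A i)) := by
  have hstep : ∀ a ∈ S, a + 4 ∈ S := fun a ha => hadd a ha 4 h4
  have hmul : ∀ k, 4 * k ∈ S := by
    intro k
    induction k with
    | zero => exact h0
    | succ k ih => exact hstep _ ih
  refine ⟨fun i => {x | x ≤ γ ∧ γ - x ∉ S ∧ (γ - x) % 4 = i.val + 1}, ?_, ?_, fun i => Or.inr ?_⟩
  · ext x
    simp only [Set.mem_ofPred_eq, Set.mem_iUnion]
    constructor
    · rintro ⟨hx, hxS⟩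
      have hmod : (γ - x) % 4 ≠ 0 := fun h => hxS (by
        rw [show γ - x = 4 * ((γ - x) / 4) by omega]
        exact hmul _)
      exact ⟨⟨(γ - x) % 4 - 1, by omega⟩, hx, hxS, by simp only; omega⟩
    · rintro ⟨i, hx, hxS, -⟩
      exact ⟨hx, hxS⟩
  · intro i j hij
    refine Set.disjoint_left.2 fun x hxi hxj => hij (Fin.ext ?_)
    have hi := hxi.2.2
    have hj := hxj.2.2
    omega
  · refine isAP_four_setOf_sub_notMem S hstep γ (fun a ha => hγ.2 ha) _ (by omega) ?_
    fin_cases i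
    exacts [h1, h2, h3]
end
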